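/- arXiv:2002.10035 — 2 statements merged into one kernel-verified Lean document; each statement's English description precedes it below -/
import Mathlib

section
/- There exists a set of 644703872849 four-dimensional subspaces of F_2^{17} whose pairwise subspace distance is at least 4; that is, A_2(17,4,4) ≥ 644703872849. -/
/-- The subspace distance `d_S(U,W) = 2·dim(U+W) − dim U − dim W` between two
subspaces of an `F`-vector space. -/
noncomputable def subspaceDist {F V : Type*} [Field F] [AddCommGroup V] [Module F V]
    (U W : Submodule F V) : ℕ :=
  2 * Module.finrank F ↥(U ⊔ W) - Module.finrank F ↥U - Module.finrank F ↥W

/-- The row space `im(A)` of a matrix `A`, i.e. the span of its rows. -/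
def rowSpace {F : Type*} [Field F] {k n : ℕ} (A : Matrix (Fin k) (Fin n) F) :
    Submodule F (Fin n → F) :=
  Submodule.span F (Set.range fun i : Fin k => A i)

/-- Horizontal concatenation `(U | M)` of two matrices with the same number of rows. -/
def hcat {F : Type*} [Field F] {k n1 n2 : ℕ} (U : Matrix (Fin k) (Fin n1) F)
    (M : Matrix (Fin k) (Fin n2) F) : Matrix (Fin k) (Fin (n1 + n2)) F :=
  Matrix.of fun i => Fin.append (U i) (M i)

/-- The projection of `F^(n1+n2)` onto the first `n1` coordinates. -/
noncomputable def proj1 (F : Type*) [Field F] (n1 n2 : ℕ) :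
    (Fin (n1 + n2) → F) →ₗ[F] (Fin n1 → F) :=
  LinearMap.funLeft F F (Fin.castAdd n2)

open Module

section LinearAlgebra

variable {F X Y : Type*} [Field F] [AddCommGroup X] [Module F X] [AddCommGroup Y] [Module F Y]

/-- The dimension of a subspace of `X × Y` is that of its projection to `X` plus that of its
intersection with `Y`. -/
theorem finrank_map_fst_add_finrank_comap_inr [FiniteDimensional F X] [FiniteDimensional F Y]
    (Z : Submodule F (X × Y)) :
    finrank F ↥(Z.map (LinearMap.fst F X Y)) + finrank F ↥(Z.comap (LinearMap.inr F X Y)) =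
      finrank F ↥Z := by
  have h := LinearMap.finrank_range_add_finrank_ker ((LinearMap.fst F X Y).domRestrict Z)
  rw [LinearMap.range_domRestrict] at h
  rw [← h, add_right_inj]
  let f : ↥(Z.comap (LinearMap.inr F X Y)) →ₗ[F] Z :=
    ((LinearMap.inr F X Y).comp (Submodule.subtype _)).codRestrict Z fun y => y.2
  have hf : Function.Injective f := fun a b hab => by
    have := congrArg (fun z : Z => z.1.2) hab
    exact Subtype.ext this
  rw [← LinearMap.finrank_range_of_inj hf]
  suffices LinearMap.range f = LinearMap.ker ((LinearMap.fst F X Y).domRestrict Z) by rw [this]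
  ext ⟨⟨x, y⟩, hz⟩
  constructor
  · rintro ⟨⟨a, ha⟩, h⟩
    have := congrArg (fun z : Z => z.1.1) h
    exact this.symm
  · intro hx
    obtain rfl : x = 0 := hx
    exact ⟨⟨y, hz⟩, rfl⟩

/-- If `B` projects injectively to `X`, then so does its intersection with any `B'`. -/
theorem finrank_inf_le_finrank_map_fst_inf [FiniteDimensional F X] [FiniteDimensional F Y]
    {B B' : Submodule F (X × Y)}
    (h : finrank F ↥B ≤ finrank F ↥(B.map (LinearMap.fst F X Y))) :
    finrank F ↥(B ⊓ B') ≤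
      finrank F ↥(B.map (LinearMap.fst F X Y) ⊓ B'.map (LinearMap.fst F X Y)) := by
  have h1 := finrank_map_fst_add_finrank_comap_inr B
  have h2 := finrank_map_fst_add_finrank_comap_inr (B ⊓ B')
  have h3 : finrank F ↥((B ⊓ B').comap (LinearMap.inr F X Y)) ≤
      finrank F ↥(B.comap (LinearMap.inr F X Y)) :=
    Submodule.finrank_mono (Submodule.comap_mono inf_le_left)
  have h4 := Submodule.finrank_mono (Submodule.map_inf_le (LinearMap.fst F X Y) (p := B) (q := B'))
  omega

theorem finrank_inf_le_map_fst_inf_add_comap_inr_inf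
    [FiniteDimensional F X] [FiniteDimensional F Y] (B B' : Submodule F (X × Y)) :
    finrank F ↥(B ⊓ B') ≤
      finrank F ↥(B.map (LinearMap.fst F X Y) ⊓ B'.map (LinearMap.fst F X Y)) +
      finrank F ↥(B.comap (LinearMap.inr F X Y) ⊓ B'.comap (LinearMap.inr F X Y)) := by
  have h2 := finrank_map_fst_add_finrank_comap_inr (B ⊓ B')
  have h4 := Submodule.finrank_mono (Submodule.map_inf_le (LinearMap.fst F X Y) (p := B) (q := B'))
  rw [Submodule.comap_inf] at h2
  omega

theorem finrank_submodule_prod [FiniteDimensional F X] [FiniteDimensional F Y]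
    (U : Submodule F X) (W : Submodule F Y) :
    finrank F ↥(U.prod W) = finrank F ↥U + finrank F ↥W := by
  rw [← finrank_map_fst_add_finrank_comap_inr, Submodule.prod_map_fst, Submodule.prod_comap_inr]

theorem finrank_inf_lt_left [FiniteDimensional F X] {U U' : Submodule F X} (h : ¬ U ≤ U') :
    finrank F ↥(U ⊓ U') < finrank F ↥U :=
  Submodule.finrank_lt_finrank_of_lt (lt_of_le_of_ne inf_le_left fun e => h (inf_eq_left.1 e))

end LinearAlgebra

section RankMetric

/-- For `0 < dim U ≤ dim W` there is a space of linear maps `U → W` of dimension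
`dim W * (dim U - 1)` in which all nonzero maps have rank at least `2`
(a maximum rank distance code). -/
theorem exists_submodule_rank_ge_two {p : ℕ} [Fact p.Prime] {U W : Type*} [AddCommGroup U]
    [Module (ZMod p) U] [FiniteDimensional (ZMod p) U] [AddCommGroup W] [Module (ZMod p) W]
    [FiniteDimensional (ZMod p) W] (h0 : 0 < finrank (ZMod p) U)
    (h : finrank (ZMod p) U ≤ finrank (ZMod p) W) :
    ∃ G : Submodule (ZMod p) (U →ₗ[ZMod p] W),
      finrank (ZMod p) G = finrank (ZMod p) W * (finrank (ZMod p) U - 1) ∧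
      ∀ φ ∈ G, φ ≠ 0 → finrank (ZMod p) ↥(LinearMap.ker φ) + 2 ≤ finrank (ZMod p) U := by
  let K := GaloisField p (finrank (ZMod p) W)
  have hK : finrank (ZMod p) W = finrank (ZMod p) K := (GaloisField.finrank p (by omega)).symm
  have : FiniteDimensional (ZMod p) K := FiniteDimensional.of_finrank_pos (by omega)
  obtain ⟨ι, hι⟩ : ∃ ι : U →ₗ[ZMod p] K, Function.Injective ι :=
    finrank_le_iff_exists_linearMap.1 (by omega)
  let j : W ≃ₗ[ZMod p] K := LinearEquiv.ofFinrankEq W K hK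
  let b := finBasis (ZMod p) U
  let S : (U →ₗ[ZMod p] W) →ₗ[ZMod p] K :=
    ∑ i, (LinearMap.mulLeft (ZMod p) (ι (b i))).comp (j.toLinearMap.comp (LinearMap.applyₗ (b i)))
  have hS : ∀ φ, S φ = ∑ i, ι (b i) * j (φ (b i)) := fun φ => by simp [S]
  have hsurj : Function.Surjective S := fun y => by
    let i0 : Fin (finrank (ZMod p) U) := ⟨0, h0⟩
    have hne : ι (b i0) ≠ 0 := fun e => b.ne_zero i0 (hι (by rw [e, map_zero]))
    refine ⟨b.constr ℕ (Pi.single i0 (j.symm (y / ι (b i0)))), ?_⟩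
    rw [hS, Finset.sum_eq_single i0]
    · rw [Basis.constr_basis, Pi.single_eq_same, LinearEquiv.apply_symm_apply]
      exact mul_div_cancel₀ _ hne
    · intro i _ hi
      rw [Basis.constr_basis, Pi.single_eq_of_ne hi, map_zero, mul_zero]
    · simp
  refine ⟨LinearMap.ker S, ?_, fun φ hφ hne => ?_⟩
  · have := LinearMap.finrank_range_add_finrank_ker S
    rw [LinearMap.range_eq_top.2 hsurj, finrank_top, finrank_linearMap, ← hK] at this
    rw [Nat.mul_sub_one, mul_comm]
    omega
  · by_contra hlt
    have hrk := LinearMap.finrank_range_add_finrank_ker φ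
    have h1 : finrank (ZMod p) ↥(LinearMap.range φ) ≤ 1 := by omega
    obtain ⟨w, hw⟩ := finrank_le_one_iff.1 h1
    have hc : ∀ u, ∃ c : ZMod p, φ u = c • (w : W) := fun u => by
      obtain ⟨c, hc⟩ := hw ⟨φ u, u, rfl⟩
      exact ⟨c, (congrArg Subtype.val hc).symm⟩
    choose c hc using hc
    have hz : ι (∑ i, c (b i) • b i) * j (w : W) = 0 := by
      rw [← LinearMap.mem_ker.1 hφ, hS, map_sum, Finset.sum_mul]
      refine Finset.sum_congr rfl fun i _ => ?_
      rw [hc (b i), map_smul, map_smul, smul_mul_assoc, mul_smul_comm]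
    apply hne
    rcases mul_eq_zero.1 hz with hz | hz
    · have h2 : ∑ i, c (b i) • b i = 0 := hι (by rw [hz, map_zero])
      have h3 := Fintype.linearIndependent_iff.1 b.linearIndependent _ h2
      refine b.ext fun i => ?_
      rw [hc, h3, zero_smul, LinearMap.zero_apply]
    · have h2 : (w : W) = 0 := j.injective (by rw [hz, map_zero])
      ext u
      rw [hc, h2, smul_zero, LinearMap.zero_apply]

end RankMetric

section SubspaceCode

/-- A set of `k`-dimensional subspaces that pairwise meet in dimension at most `k - 2`, that is,
whose pairwise subspace distance is at least `4`. -/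
structure IsSubspaceCode {F X : Type*} [Field F] [AddCommGroup X] [Module F X] (k : ℕ)
    (S : Set (Submodule F X)) : Prop where
  finrank_eq : ∀ U ∈ S, finrank F ↥U = k
  inf_le : ∀ U ∈ S, ∀ U' ∈ S, U ≠ U' → finrank F ↥(U ⊓ U') + 2 ≤ k

variable {F X Y : Type*} [Field F] [AddCommGroup X] [Module F X] [AddCommGroup Y] [Module F Y]

theorem IsSubspaceCode.mono {k : ℕ} {S T : Set (Submodule F X)} (hT : IsSubspaceCode k T)
    (h : S ⊆ T) : IsSubspaceCode k S :=
  ⟨fun U hU => hT.1 U (h hU), fun U hU U' hU' => hT.2 U (h hU) U' (h hU')⟩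

theorem IsSubspaceCode.union [Finite X] {k : ℕ} {S T : Set (Submodule F X)}
    (hS : IsSubspaceCode k S) (hT : IsSubspaceCode k T)
    (h : ∀ U ∈ S, ∀ U' ∈ T, finrank F ↥(U ⊓ U') + 2 ≤ k) :
    IsSubspaceCode k (S ∪ T) ∧ (S ∪ T).ncard = S.ncard + T.ncard := by
  refine ⟨⟨?_, ?_⟩, Set.ncard_union_eq (Set.disjoint_left.2 fun U hU hU' => ?_)⟩
  · rintro U (hU | hU)
    exacts [hS.1 U hU, hT.1 U hU]
  · rintro U (hU | hU) U' (hU' | hU') hne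
    · exact hS.2 U hU U' hU' hne
    · exact h U hU U' hU'
    · rw [inf_comm]
      exact h U' hU' U hU
    · exact hT.2 U hU U' hU' hne
  · have h1 := h U hU U hU'
    rw [inf_idem, hS.1 U hU] at h1
    omega

theorem IsSubspaceCode.iUnion [Finite X] {k N : ℕ} {ι : Type*} [Finite ι]
    {C : ι → Set (Submodule F X)} (hC : ∀ i, IsSubspaceCode k (C i)) (hN : ∀ i, (C i).ncard = N)
    (h : ∀ i j, i ≠ j → ∀ U ∈ C i, ∀ U' ∈ C j, finrank F ↥(U ⊓ U') + 2 ≤ k) :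
    IsSubspaceCode k (⋃ i, C i) ∧ (⋃ i, C i).ncard = Nat.card ι * N := by
  refine ⟨⟨fun U hU => ?_, fun U hU U' hU' hne => ?_⟩, ?_⟩
  · obtain ⟨i, hi⟩ := Set.mem_iUnion.1 hU
    exact (hC i).1 U hi
  · obtain ⟨i, hi⟩ := Set.mem_iUnion.1 hU
    obtain ⟨j, hj⟩ := Set.mem_iUnion.1 hU'
    by_cases hij : i = j
    · subst hij
      exact (hC i).2 U hi U' hj hne
    · exact h i j hij U hi U' hj
  · have := Fintype.ofFinite ι
    rw [Set.ncard_iUnion_of_finite (fun _ => Set.toFinite _), finsum_eq_sum_of_fintype]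
    · simp [hN]
    · intro i j hij
      refine Set.disjoint_left.2 fun U hU hU' => ?_
      have h1 := h i j hij U hU U hU'
      rw [inf_idem, (hC i).1 U hU] at h1
      omega

theorem finrank_comap_of_surjective [FiniteDimensional F X] {f : X →ₗ[F] Y}
    (hf : Function.Surjective f) (U : Submodule F Y) :
    finrank F ↥(U.comap f) = finrank F ↥U + finrank F ↥(LinearMap.ker f) := by
  have h := LinearMap.finrank_range_add_finrank_ker (f.domRestrict (U.comap f))
  rw [LinearMap.range_domRestrict, Submodule.map_comap_eq_of_surjective hf] at h
  rw [← h, add_right_inj, LinearMap.ker_domRestrict]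
  have hle : LinearMap.ker f ≤ U.comap f := fun x hx => by simp [LinearMap.mem_ker.1 hx]
  exact LinearEquiv.finrank_eq (Submodule.comapSubtypeEquivOfLe hle)

theorem IsSubspaceCode.comap [FiniteDimensional F X] {k : ℕ} {S : Set (Submodule F Y)}
    (hS : IsSubspaceCode k S) {f : X →ₗ[F] Y} (hf : Function.Surjective f) :
    IsSubspaceCode (k + finrank F ↥(LinearMap.ker f)) (Submodule.comap f '' S) ∧
      (Submodule.comap f '' S).ncard = S.ncard := by
  refine ⟨⟨?_, ?_⟩, Set.ncard_image_of_injective _ (Submodule.comap_injective_of_surjective hf)⟩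
  · rintro _ ⟨U, hU, rfl⟩
    rw [finrank_comap_of_surjective hf, hS.1 U hU]
  · rintro _ ⟨U, hU, rfl⟩ _ ⟨U', hU', rfl⟩ hne
    rw [← Submodule.comap_inf, finrank_comap_of_surjective hf]
    have := hS.2 U hU U' hU' fun e => hne (e ▸ rfl)
    omega

theorem IsSubspaceCode.comap_equiv [FiniteDimensional F X] {k : ℕ} {S : Set (Submodule F Y)}
    (hS : IsSubspaceCode k S) (e : X ≃ₗ[F] Y) :
    IsSubspaceCode k (Submodule.comap e.toLinearMap '' S) ∧
      (Submodule.comap e.toLinearMap '' S).ncard = S.ncard := by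
  have h := hS.comap (f := e.toLinearMap) e.surjective
  rwa [LinearEquiv.ker, finrank_bot, add_zero] at h

end SubspaceCode

section Lifting

variable {p : ℕ} [Fact p.Prime] {X W : Type*} [AddCommGroup X] [Module (ZMod p) X] [Finite X]
  [AddCommGroup W] [Module (ZMod p) W] [Finite W]

/-- The graphs over a subspace `U` of a maximum rank distance code of linear maps `U → W`. -/
theorem exists_lifted_code (U : Submodule (ZMod p) X) (h0 : 0 < finrank (ZMod p) ↥U)
    (h : finrank (ZMod p) ↥U ≤ finrank (ZMod p) W) :
    ∃ C : Set (Submodule (ZMod p) (X × W)), IsSubspaceCode (finrank (ZMod p) ↥U) C ∧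
      C.ncard = p ^ (finrank (ZMod p) W * (finrank (ZMod p) ↥U - 1)) ∧
      ∀ B ∈ C, B.map (LinearMap.fst (ZMod p) X W) = U := by
  obtain ⟨G, hG, hrank⟩ := exists_submodule_rank_ge_two h0 h
  let gr : (U →ₗ[ZMod p] W) → Submodule (ZMod p) (X × W) := fun φ =>
    LinearMap.range (U.subtype.prod φ)
  have hfst : ∀ φ, (gr φ).map (LinearMap.fst (ZMod p) X W) = U := fun φ => by
    rw [← LinearMap.range_comp, LinearMap.fst_prod, Submodule.range_subtype]
  have hinj : ∀ φ : U →ₗ[ZMod p] W, Function.Injective (U.subtype.prod φ) := fun φ a b hab =>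
    Subtype.ext (congrArg Prod.fst hab)
  have hdim : ∀ φ, finrank (ZMod p) ↥(gr φ) = finrank (ZMod p) ↥U := fun φ =>
    LinearMap.finrank_range_of_inj (hinj φ)
  have hmem : ∀ φ (u : U) (w : W), ((u : X), w) ∈ gr φ → w = φ u := by
    rintro φ u w ⟨v, hv⟩
    obtain rfl : v = u := Subtype.ext (congrArg Prod.fst hv)
    exact (congrArg Prod.snd hv).symm
  have hgr : Function.Injective gr := fun φ ψ e => by
    ext u
    exact hmem ψ u _ (e ▸ ⟨u, rfl⟩)
  refine ⟨gr '' G, ⟨?_, ?_⟩, ?_, ?_⟩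
  · rintro _ ⟨φ, -, rfl⟩
    exact hdim φ
  · rintro _ ⟨φ, hφ, rfl⟩ _ ⟨ψ, hψ, rfl⟩ hne
    refine le_trans (Nat.add_le_add_right ?_ 2)
      (hrank (φ - ψ) (G.sub_mem hφ hψ) (sub_ne_zero.2 fun e => hne (e ▸ rfl)))
    have hle : gr φ ⊓ gr ψ ≤ (LinearMap.ker (φ - ψ)).map (U.subtype.prod φ) := by
      rintro _ ⟨⟨u, rfl⟩, hu⟩
      refine ⟨u, ?_, rfl⟩
      have := hmem ψ u _ hu
      simpa [sub_eq_zero] using this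
    exact (Submodule.finrank_mono hle).trans (Submodule.finrank_map_le _ _)
  · rw [Set.ncard_image_of_injective _ hgr, ← hG]
    have := Module.natCard_eq_pow_finrank (K := ZMod p) (V := G)
    rwa [Nat.card_zmod] at this
  · rintro _ ⟨φ, -, rfl⟩
    exact hfst φ

/-- The linkage construction: lifting all codewords of a code by maximum rank distance codes. -/
theorem IsSubspaceCode.exists_lift {k : ℕ} {S : Set (Submodule (ZMod p) X)}
    (hS : IsSubspaceCode k S) (h0 : 0 < k) (h : k ≤ finrank (ZMod p) W) :
    ∃ C : Set (Submodule (ZMod p) (X × W)), IsSubspaceCode k C ∧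
      C.ncard = S.ncard * p ^ (finrank (ZMod p) W * (k - 1)) ∧
      ∀ B ∈ C, B.map (LinearMap.fst (ZMod p) X W) ∈ S := by
  have hU : ∀ U : S, ∃ C : Set (Submodule (ZMod p) (X × W)), IsSubspaceCode k C ∧
      C.ncard = p ^ (finrank (ZMod p) W * (k - 1)) ∧
      ∀ B ∈ C, B.map (LinearMap.fst (ZMod p) X W) = U := fun U => by
    have hk := hS.1 U U.2
    have := exists_lifted_code (W := W) (U : Submodule (ZMod p) X) (hk ▸ h0) (hk ▸ h)
    rwa [hk] at this
  choose C hC hN hfst using hU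
  obtain ⟨h1, h2⟩ := IsSubspaceCode.iUnion hC hN fun U U' hne B hB B' hB' => by
    refine le_trans (Nat.add_le_add_right ?_ 2)
      (hS.2 U U.2 U' U'.2 fun e => hne (Subtype.ext e))
    rw [← hfst U B hB, ← hfst U' B' hB']
    refine finrank_inf_le_finrank_map_fst_inf ?_
    rw [hfst U B hB, (hC U).1 B hB, hS.1 U U.2]
  refine ⟨⋃ U, C U, h1, h2, fun B hB => ?_⟩
  obtain ⟨U, hB⟩ := Set.mem_iUnion.1 hB
  rw [hfst U B hB]
  exact U.2

end Lifting

section Packing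

/-- Bases of the 35 two-dimensional subspaces of `F_2^4`, arranged into 7 spreads of 5 subspaces.
The bits of each number are the coordinates of a vector. -/
def packingBasis (i : Fin 7) (j : Fin 5) : Fin 2 → ℕ :=
  (![![![1, 2], ![4, 8], ![5, 10], ![6, 11], ![7, 9]],
    ![![1, 4], ![2, 8], ![3, 13], ![6, 9], ![7, 11]],
    ![![1, 6], ![2, 9], ![3, 12], ![4, 10], ![5, 8]],
    ![![1, 8], ![2, 12], ![3, 5], ![4, 11], ![7, 10]],
    ![![1, 10], ![2, 13], ![3, 4], ![5, 9], ![6, 8]],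
    ![![1, 12], ![2, 4], ![3, 9], ![5, 11], ![7, 8]],
    ![![1, 14], ![2, 5], ![3, 8], ![4, 9], ![6, 10]]] : Fin 7 → Fin 5 → Fin 2 → ℕ) i j

/-- The vector of `F_2^4` with the coordinates given by `packingBasis`. -/
def packingVec (i : Fin 7) (j : Fin 5) (a : Fin 2) : Fin 4 → ZMod 2 :=
  fun t => if (packingBasis i j a).testBit t then 1 else 0

theorem packingVec_independent : ∀ i j, ∀ a b : ZMod 2,
    a • packingVec i j 0 + b • packingVec i j 1 = 0 → a = 0 ∧ b = 0 := by
  decide +kernel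

theorem packingVec_spread : ∀ i j k, j ≠ k → ∀ a b c d : ZMod 2,
    a • packingVec i j 0 + b • packingVec i j 1 = c • packingVec i k 0 + d • packingVec i k 1 →
      a = 0 ∧ b = 0 := by
  decide +kernel

theorem packingVec_distinct : ∀ i j i' j', i ≠ i' →
    ¬ ((∃ c d : ZMod 2, c • packingVec i' j' 0 + d • packingVec i' j' 1 = packingVec i j 0) ∧
      ∃ c d : ZMod 2, c • packingVec i' j' 0 + d • packingVec i' j' 1 = packingVec i j 1) := by
  decide +kernel

/-- The two-dimensional subspaces of `F_2^4` can be partitioned into 7 spreads. -/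
theorem exists_packing : ∃ P : Fin 7 → Fin 5 → Submodule (ZMod 2) (Fin 4 → ZMod 2),
    (∀ i j, finrank (ZMod 2) ↥(P i j) = 2) ∧
    (∀ i j k, j ≠ k → P i j ⊓ P i k = ⊥) ∧
    ∀ i j i' j', i ≠ i' → finrank (ZMod 2) ↥(P i j ⊓ P i' j') ≤ 1 := by
  let P : Fin 7 → Fin 5 → Submodule (ZMod 2) (Fin 4 → ZMod 2) := fun i j =>
    Submodule.span (ZMod 2) {packingVec i j 0, packingVec i j 1}
  have hP : ∀ i j, finrank (ZMod 2) ↥(P i j) = 2 := fun i j => by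
    have h := LinearIndependent.pair_iff.2 (packingVec_independent i j)
    have := finrank_span_eq_card h
    rwa [Matrix.range_cons_cons_empty, Fintype.card_fin] at this
  refine ⟨P, hP, fun i j k hjk => ?_, fun i j i' j' hii => ?_⟩
  · refine (Submodule.eq_bot_iff _).2 fun x hx => ?_
    obtain ⟨a, b, rfl⟩ := Submodule.mem_span_pair.1 hx.1
    obtain ⟨c, d, h⟩ := Submodule.mem_span_pair.1 hx.2
    obtain ⟨rfl, rfl⟩ := packingVec_spread i j k hjk a b c d h.symm
    simp
  · by_contra hlt
    have hle : P i j ≤ P i' j' := by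
      by_contra hle
      have := finrank_inf_lt_left hle
      have := hP i j
      omega
    exact packingVec_distinct i j i' j' hii
      ⟨Submodule.mem_span_pair.1 (hle (Submodule.subset_span (by simp))),
        Submodule.mem_span_pair.1 (hle (Submodule.subset_span (by simp)))⟩

end Packing

section Construction

theorem finrank_ker_fst {F X Y : Type*} [Field F] [AddCommGroup X] [Module F X] [AddCommGroup Y]
    [Module F Y] : finrank F ↥(LinearMap.ker (LinearMap.fst F X Y)) = finrank F Y := by
  rw [LinearMap.ker_fst, LinearMap.finrank_range_of_inj LinearMap.inr_injective]

theorem map_fst_comap_equiv {F X V Y W : Type*} [Field F] [AddCommGroup X] [Module F X]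
    [AddCommGroup V] [Module F V] [AddCommGroup Y] [Module F Y] [AddCommGroup W] [Module F W]
    (e : (X × V) ≃ₗ[F] (X × Y) × W) (he : ∀ v, (e v).1.1 = v.1) (Z : Submodule F ((X × Y) × W)) :
    (Z.comap e.toLinearMap).map (LinearMap.fst F X V) =
      (Z.map (LinearMap.fst F (X × Y) W)).map (LinearMap.fst F X Y) := by
  have h : LinearMap.fst F X V =
      (LinearMap.fst F X Y ∘ₗ LinearMap.fst F (X × Y) W) ∘ₗ e.toLinearMap :=
    LinearMap.ext fun v => (he v).symm
  rw [h, Submodule.map_comp, Submodule.map_comap_eq_of_surjective e.surjective, Submodule.map_comp]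

/-- A code of subspaces of `X × W` projecting onto `L` and meeting `W` exactly in `M`. -/
theorem exists_code_of_fst_of_inr {p : ℕ} [Fact p.Prime] {X W : Type*} [AddCommGroup X]
    [Module (ZMod p) X] [Finite X] [AddCommGroup W] [Module (ZMod p) W] [Finite W]
    (L : Submodule (ZMod p) X) (M : Submodule (ZMod p) W) (h0 : 0 < finrank (ZMod p) ↥L)
    (h : finrank (ZMod p) ↥L + finrank (ZMod p) ↥M ≤ finrank (ZMod p) W) :
    ∃ C : Set (Submodule (ZMod p) (X × W)),
      IsSubspaceCode (finrank (ZMod p) ↥L + finrank (ZMod p) ↥M) C ∧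
      C.ncard = p ^ ((finrank (ZMod p) W - finrank (ZMod p) ↥M) * (finrank (ZMod p) ↥L - 1)) ∧
      ∀ B ∈ C, B.map (LinearMap.fst (ZMod p) X W) = L ∧
        B.comap (LinearMap.inr (ZMod p) X W) = M := by
  have : Finite (W ⧸ M) := Finite.of_surjective _ M.mkQ_surjective
  have hq := M.finrank_quotient_add_finrank
  obtain ⟨C, hC, hN, hL⟩ := exists_lifted_code (W := W ⧸ M) L h0 (by omega)
  let f : X × W →ₗ[ZMod p] X × (W ⧸ M) := LinearMap.prodMap LinearMap.id M.mkQ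
  have hf : Function.Surjective f := Function.surjective_id.prodMap M.mkQ_surjective
  have hker : finrank (ZMod p) ↥(LinearMap.ker f) = finrank (ZMod p) ↥M := by
    rw [LinearMap.ker_prodMap, finrank_submodule_prod, LinearMap.ker_id, finrank_bot, zero_add,
      Submodule.ker_mkQ]
  obtain ⟨h1, h2⟩ := hC.comap hf
  rw [hker] at h1
  refine ⟨_, h1, ?_, ?_⟩
  · rw [h2, hN, ← hq, Nat.add_sub_cancel]
  · rintro _ ⟨B, hB, rfl⟩
    have hfst : (B.comap f).map (LinearMap.fst (ZMod p) X W) = L := by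
      have hc : LinearMap.fst (ZMod p) X W = LinearMap.fst (ZMod p) X (W ⧸ M) ∘ₗ f := rfl
      rw [hc, Submodule.map_comp, Submodule.map_comap_eq_of_surjective hf, hL B hB]
    refine ⟨hfst, ?_⟩
    have hz : B.comap (LinearMap.inr (ZMod p) X (W ⧸ M)) = ⊥ := by
      have := finrank_map_fst_add_finrank_comap_inr B
      rw [hL B hB, hC.1 B hB] at this
      exact Submodule.finrank_eq_zero.1 (by omega)
    have hc : f ∘ₗ LinearMap.inr (ZMod p) X W = LinearMap.inr (ZMod p) X (W ⧸ M) ∘ₗ M.mkQ := by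
      ext x <;> simp [f]
    rw [← Submodule.comap_comp, hc, Submodule.comap_comp, hz]
    exact M.ker_mkQ

/-- A code of 4796 four-dimensional subspaces of `F_2^8`, and a code of at least 88
three-dimensional subspaces none of which lies in a codeword of the former. -/
theorem exists_code_dim_eight :
    ∃ S E : Set (Submodule (ZMod 2) ((Fin 4 → ZMod 2) × (Fin 4 → ZMod 2))),
    IsSubspaceCode 4 S ∧ S.ncard = 4796 ∧ IsSubspaceCode 3 E ∧ 88 ≤ E.ncard ∧
      ∀ Z ∈ E, ∀ U ∈ S, ¬ Z ≤ U := by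
  obtain ⟨P, hP, hspread, hdist⟩ := exists_packing
  have h4 : finrank (ZMod 2) (Fin 4 → ZMod 2) = 4 := finrank_fin_fun _
  obtain ⟨S₁, hS₁, hN₁, hfst₁⟩ := exists_code_of_fst_of_inr (p := 2)
    (X := Fin 4 → ZMod 2) (W := Fin 4 → ZMod 2) ⊤ ⊥
    (by simp) (by simp)
  simp only [finrank_top, finrank_bot, h4] at hS₁ hN₁
  have hC : ∀ x : Fin 7 × Fin 5 × Fin 5,
      ∃ C : Set (Submodule (ZMod 2) ((Fin 4 → ZMod 2) × (Fin 4 → ZMod 2))),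
      IsSubspaceCode 4 C ∧ C.ncard = 4 ∧
      ∀ B ∈ C, B.map (LinearMap.fst (ZMod 2) (Fin 4 → ZMod 2) (Fin 4 → ZMod 2)) = P x.1 x.2.1 ∧
        B.comap (LinearMap.inr (ZMod 2) (Fin 4 → ZMod 2) (Fin 4 → ZMod 2)) = P x.1 x.2.2 := fun x => by
    have := exists_code_of_fst_of_inr (P x.1 x.2.1) (P x.1 x.2.2) (by rw [hP]; norm_num)
      (by rw [hP, hP, h4])
    simp only [hP, h4] at this
    exact this
  choose C hC hCN hCP using hC
  have hP1 : ∀ i j i' j', (i, j) ≠ (i', j') → finrank (ZMod 2) ↥(P i j ⊓ P i' j') ≤ 1 := by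
    intro i j i' j' hne
    by_cases hi : i = i'
    · subst hi
      rw [hspread i j j' fun e => hne (by rw [e]), finrank_bot]
      exact Nat.zero_le 1
    · exact hdist i j i' j' hi
  have hP2 : ∀ i j k, finrank (ZMod 2) ↥(P i j ⊓ P i k) ≤ 2 := fun i j k =>
    (Submodule.finrank_mono inf_le_left).trans (hP i j).le
  obtain ⟨hS₂, hN₂⟩ := IsSubspaceCode.iUnion hC hCN fun x y hne B hB B' hB' => by
    obtain ⟨i, j, k⟩ := x
    obtain ⟨i', j', k'⟩ := y
    have h := finrank_inf_le_map_fst_inf_add_comap_inr_inf B B'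
    rw [(hCP _ B hB).1, (hCP _ B hB).2, (hCP _ B' hB').1, (hCP _ B' hB').2] at h
    dsimp only at h
    by_cases hi : i = i'
    · subst hi
      by_cases hj : j = j'
      · have hk : k ≠ k' := fun hk => hne (by rw [hj, hk])
        rw [hspread i k k' hk, finrank_bot] at h
        have := hP2 i j j'
        omega
      · rw [hspread i j j' hj, finrank_bot] at h
        have := hP2 i k k'
        omega
    · have := hdist i j i' j' hi
      have := hdist i k i' k' hi
      omega
  obtain ⟨hS, hN⟩ := hS₁.union hS₂ fun U hU U' hU' => by
    obtain ⟨x, hU'⟩ := Set.mem_iUnion.1 hU'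
    have h := finrank_inf_le_map_fst_inf_add_comap_inr_inf U U'
    rw [(hfst₁ U hU).2, (hCP x U' hU').1, (hfst₁ U hU).1, bot_inf_eq, top_inf_eq, hP,
      finrank_bot] at h
    omega
  -- Lift the planes over two disjoint members of the first spread.
  let m : Fin 2 → Fin 5 := Fin.castLE (by norm_num)
  have hm : Function.Injective m := Fin.castLE_injective _
  let S₀ : Set (Submodule (ZMod 2) (Fin 4 → ZMod 2)) := Set.range fun a => P 0 (m a)
  have hS₀ : IsSubspaceCode 2 S₀ := by
    constructor
    · rintro _ ⟨a, rfl⟩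
      exact hP 0 (m a)
    · rintro _ ⟨a, rfl⟩ _ ⟨b, rfl⟩ hne
      dsimp only at hne ⊢
      rw [hspread 0 _ _ fun e => hne (by rw [e]), finrank_bot]
  have hN₀ : S₀.ncard = 2 := by
    have hinj : Function.Injective fun a => P 0 (m a) := fun a b hab => by
      by_contra hne
      have h := hspread 0 (m a) (m b) fun e => hne (hm e)
      dsimp only at hab
      rw [← hab, inf_idem] at h
      have := hP 0 (m a)
      rw [h, finrank_bot] at this
      omega
    exact (Nat.card_range_of_injective hinj).trans (by simp)
  obtain ⟨hS₀', hN₀'⟩ := hS₀.comap (f := LinearMap.fst (ZMod 2) (Fin 4 → ZMod 2) (ZMod 2))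
    Prod.fst_surjective
  rw [finrank_ker_fst, finrank_self] at hS₀'
  obtain ⟨E₀, hE₀, hNE₀, hfstE₀⟩ := hS₀'.exists_lift (W := Fin 3 → ZMod 2) (by norm_num) (by simp)
  let b : (Fin 4 → ZMod 2) ≃ₗ[ZMod 2] ZMod 2 × (Fin 3 → ZMod 2) :=
    LinearEquiv.ofFinrankEq _ _ (by simp)
  let e : ((Fin 4 → ZMod 2) × (Fin 4 → ZMod 2)) ≃ₗ[ZMod 2]
      ((Fin 4 → ZMod 2) × ZMod 2) × (Fin 3 → ZMod 2) :=
    ((LinearEquiv.refl (ZMod 2) (Fin 4 → ZMod 2)).prodCongr b).trans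
      (LinearEquiv.prodAssoc (ZMod 2) (Fin 4 → ZMod 2) (ZMod 2) (Fin 3 → ZMod 2)).symm
  obtain ⟨hE, hNE⟩ := hE₀.comap_equiv e
  set E := Submodule.comap e.toLinearMap '' E₀
  rw [hNE₀, hN₀', hN₀, finrank_fin_fun] at hNE
  have hfstE : ∀ Z ∈ E, ∃ a,
      Z.map (LinearMap.fst (ZMod 2) (Fin 4 → ZMod 2) (Fin 4 → ZMod 2)) = P 0 (m a) := by
    rintro _ ⟨Z, hZ, rfl⟩
    obtain ⟨_, ⟨a, rfl⟩, ha⟩ := hfstE₀ Z hZ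
    refine ⟨a, ?_⟩
    rw [map_fst_comap_equiv e (fun _ => rfl), ← ha,
      Submodule.map_comap_eq_of_surjective Prod.fst_surjective]
  let D := ⋃ x : Fin 2 × Fin 5, C (0, m x.1, x.2)
  have hD : D.ncard ≤ 40 := by
    refine (Set.ncard_iUnion_le_of_fintype _).trans ?_
    simp [hCN]
  have hcov : ∀ Z ∈ E, ∀ U ∈ S₁ ∪ ⋃ x, C x, Z ≤ U → U ∈ D := by
    rintro Z hZ U (hU | hU) hle
    · have h := finrank_map_fst_add_finrank_comap_inr Z
      obtain ⟨a, ha⟩ := hfstE Z hZ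
      have hz : Z.comap (LinearMap.inr (ZMod 2) (Fin 4 → ZMod 2) (Fin 4 → ZMod 2)) = ⊥ :=
        le_bot_iff.1 ((Submodule.comap_mono hle).trans (hfst₁ U hU).2.le)
      rw [ha, hP, hz, finrank_bot, hE.1 Z hZ] at h
      omega
    · obtain ⟨⟨i, j, k⟩, hU⟩ := Set.mem_iUnion.1 hU
      obtain ⟨a, ha⟩ := hfstE Z hZ
      have h : P 0 (m a) ≤ P i j := by
        rw [← ha, ← (hCP _ U hU).1]
        exact Submodule.map_mono hle
      have hij : (0, m a) = (i, j) := by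
        by_contra hne
        have := hP1 _ _ _ _ hne
        rw [inf_eq_left.2 h, hP] at this
        omega
      obtain ⟨rfl, rfl⟩ := Prod.mk.inj hij
      exact Set.mem_iUnion.2 ⟨(a, k), hU⟩
  let bad := {Z ∈ E | ∃ U ∈ S₁ ∪ ⋃ x, C x, Z ≤ U}
  have hbad : bad.ncard ≤ 40 := by
    have hex : ∀ Z, ∃ U, Z ∈ bad → U ∈ S₁ ∪ (⋃ x, C x) ∧ Z ≤ U := fun Z => by
      by_cases hZ : Z ∈ bad
      · obtain ⟨-, U, hU⟩ := hZ
        exact ⟨U, fun _ => hU⟩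
      · exact ⟨⊤, fun h => absurd h hZ⟩
    choose g hg using hex
    refine (Set.ncard_le_ncard_of_injOn (t := D) g
      (fun Z hZ => hcov Z hZ.1 _ (hg Z hZ).1 (hg Z hZ).2) ?_).trans hD
    intro Z hZ Z' hZ' hgg
    by_contra hne
    have h1 := hE.2 Z hZ.1 Z' hZ'.1 hne
    have h2 := Submodule.finrank_sup_add_finrank_inf_eq Z Z'
    have h3 := Submodule.finrank_mono (sup_le (hg Z hZ).2 (hgg ▸ (hg Z' hZ').2))
    rw [hE.1 Z hZ.1, hE.1 Z' hZ'.1] at h2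
    rw [hS.1 _ (hg Z hZ).1] at h3
    omega
  refine ⟨S₁ ∪ ⋃ x, C x, E \ bad, hS, ?_, hE.mono Set.sdiff_subset, ?_,
    fun Z hZ U hU hle => hZ.2 ⟨hZ.1, U, hU, hle⟩⟩
  · rw [hN, hN₁, hN₂]
    simp
  · have := Set.ncard_sdiff_add_ncard_of_subset (s := bad) (t := E) (fun Z hZ => hZ.1)
    omega

/-- Linking a code of four-dimensional subspaces of `X` with lifts of the spaces `Z × F_2`, where
`Z` ranges over a code of three-dimensional subspaces of `X` not contained in codewords. -/
theorem exists_linked_code {X W : Type*} [AddCommGroup X] [Module (ZMod 2) X] [Finite X]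
    [AddCommGroup W] [Module (ZMod 2) W] [Finite W] (hW : 4 ≤ finrank (ZMod 2) W)
    {S E : Set (Submodule (ZMod 2) X)} (hS : IsSubspaceCode 4 S) (hE : IsSubspaceCode 3 E)
    (hSE : ∀ Z ∈ E, ∀ U ∈ S, ¬ Z ≤ U) :
    ∃ C : Set (Submodule (ZMod 2) (X × (ZMod 2 × W))), IsSubspaceCode 4 C ∧
      C.ncard = S.ncard * 2 ^ ((1 + finrank (ZMod 2) W) * 3) +
        E.ncard * 2 ^ (finrank (ZMod 2) W * 3) := by
  obtain ⟨C₁, hC₁, hN₁, hfst₁⟩ := hS.exists_lift (W := ZMod 2 × W) (by norm_num)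
    (by rw [finrank_prod]; omega)
  obtain ⟨hE', hNE'⟩ := hE.comap (f := LinearMap.fst (ZMod 2) X (ZMod 2)) Prod.fst_surjective
  rw [finrank_ker_fst, finrank_self] at hE'
  obtain ⟨C₀, hC₀, hN₀, hfst₀⟩ := hE'.exists_lift (W := W) (by norm_num) hW
  let e := (LinearEquiv.prodAssoc (ZMod 2) X (ZMod 2) W).symm
  obtain ⟨hC₂, hN₂⟩ := hC₀.comap_equiv e
  obtain ⟨h, hN⟩ := hC₁.union hC₂ fun U hU U' hU' => by
    obtain ⟨U', hU', rfl⟩ := hU'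
    obtain ⟨Z, hZ, hZU⟩ := hfst₀ U' hU'
    have h1 := finrank_inf_le_finrank_map_fst_inf (B := U) (B' := U'.comap e.toLinearMap)
      (by rw [hC₁.1 U hU, hS.1 _ (hfst₁ U hU)])
    rw [map_fst_comap_equiv e (fun _ => rfl), ← hZU,
      Submodule.map_comap_eq_of_surjective Prod.fst_surjective, inf_comm (U.map _)] at h1
    have h2 := finrank_inf_lt_left (hSE Z hZ _ (hfst₁ U hU))
    rw [hE.1 Z hZ] at h2
    omega
  refine ⟨_, h, ?_⟩
  rw [hN, hN₁, hN₂, hN₀, hNE', finrank_prod, finrank_self]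

theorem IsSubspaceCode.four_le_subspaceDist {F X : Type*} [Field F] [AddCommGroup X] [Module F X]
    [FiniteDimensional F X] {k : ℕ} {S : Set (Submodule F X)} (hS : IsSubspaceCode k S)
    {U W : Submodule F X} (hU : U ∈ S) (hW : W ∈ S) (hne : U ≠ W) : 4 ≤ subspaceDist U W := by
  have h1 := Submodule.finrank_sup_add_finrank_inf_eq U W
  have h2 := hS.2 U hU W hW hne
  rw [hS.1 U hU, hS.1 W hW] at h1
  rw [subspaceDist, hS.1 U hU, hS.1 W hW]
  omega

end Construction

theorem statement17 :
    ∃ S : Set (Submodule (ZMod 2) (Fin 17 → ZMod 2)),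
      S.ncard = 644703872849 ∧
      (∀ X ∈ S, Module.finrank (ZMod 2) ↥X = 4) ∧
      (∀ X ∈ S, ∀ Y ∈ S, X ≠ Y → 4 ≤ subspaceDist X Y) := by
  obtain ⟨S, E, hS, hN, hE, hNE, hSE⟩ := exists_code_dim_eight
  obtain ⟨C, hC, hNC⟩ := exists_linked_code (W := Fin 8 → ZMod 2) (by simp) hS hE hSE
  let e : (Fin 17 → ZMod 2) ≃ₗ[ZMod 2]
      ((Fin 4 → ZMod 2) × (Fin 4 → ZMod 2)) × (ZMod 2 × (Fin 8 → ZMod 2)) :=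
    LinearEquiv.ofFinrankEq _ _ (by simp)
  obtain ⟨hC', hNC'⟩ := hC.comap_equiv e
  obtain ⟨T, hT, hNT⟩ := Set.exists_subset_card_eq (n := 644703872849)
    (s := Submodule.comap e.toLinearMap '' C) (by
      rw [hNC', hNC, hN, finrank_fin_fun]
      omega)
  have hT' := hC'.mono hT
  exact ⟨T, hNT, hT'.1, fun U hU W hW hne => hT'.four_le_subspaceDist hU hW hne⟩
end

section
/- Let q be a prime power and suppose there exists a set of N three-dimensional subspaces of F_q^7 whose pairwise subspace distance is at least 4. Then there exists a set of N·q^6 + (q^2 + q + 1) three-dimensional subspaces of F_q^{10} whose pairwise subspace distance is at least 4; in other words, A_q(10,4,3) ≥ A_q(7,4,3)·q^6 + q^2 + q + 1. -/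
open Module in
theorem four_le_subspaceDist_iff {F V : Type*} [Field F] [AddCommGroup V] [Module F V]
    [FiniteDimensional F V] {X Y : Submodule F V} (hX : finrank F X = 3) (hY : finrank F Y = 3) :
    4 ≤ subspaceDist X Y ↔ finrank F ↥(X ⊓ Y) ≤ 1 := by
  have h := Submodule.finrank_sup_add_finrank_inf_eq X Y
  unfold subspaceDist
  omega

open Module in
/-- A family of three-dimensional subspaces meeting pairwise in dimension at most one yields a
constant-dimension code in every space of the same dimension. -/
theorem exists_code_of_family {F V W ι : Type*} [Field F] [AddCommGroup V] [Module F V]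
    [FiniteDimensional F V] [AddCommGroup W] [Module F W] [FiniteDimensional F W]
    (hVW : finrank F V = finrank F W) (g : ι → Submodule F V) (hg : ∀ i, finrank F (g i) = 3)
    (hinf : Pairwise fun i j => finrank F ↥(g i ⊓ g j) ≤ 1) :
    ∃ S : Set (Submodule F W), S.ncard = Nat.card ι ∧ (∀ X ∈ S, finrank F X = 3) ∧
      ∀ X ∈ S, ∀ Y ∈ S, X ≠ Y → 4 ≤ subspaceDist X Y := by
  let e : V ≃ₗ[F] W := LinearEquiv.ofFinrankEq V W hVW
  have hdim (i : ι) : finrank F ((g i).map e.toLinearMap) = 3 := by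
    rw [LinearEquiv.finrank_map_eq, hg]
  have hinj : Function.Injective g := by
    intro i j hij
    by_contra hne
    have hle : finrank F ↥(g i ⊓ g j) ≤ 1 := hinf hne
    rw [hij, inf_idem, hg] at hle
    omega
  refine ⟨Set.range fun i => (g i).map e.toLinearMap, ?_, ?_, ?_⟩
  · exact Set.ncard_range_of_injective
      ((Submodule.map_injective_of_injective e.injective).comp hinj)
  · rintro _ ⟨i, rfl⟩
    exact hdim i
  · rintro _ ⟨i, rfl⟩ _ ⟨j, rfl⟩ hne
    have hij : i ≠ j := fun h => hne (by rw [h])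
    rw [four_le_subspaceDist_iff (hdim i) (hdim j),
      ← Submodule.map_inf _ e.injective, LinearEquiv.finrank_map_eq]
    exact hinf hij

section LinearizedBinomial

variable {F K : Type*} [Field F] [Fintype F] [Field K] [Algebra F K]

/-- The `F`-linear map `x ↦ a x + b x ^ |F|` on a field extension `K` of the finite field `F`. -/
noncomputable def linearizedBinomial (a b : K) : K →ₗ[F] K :=
  LinearMap.mulLeft F a + LinearMap.mulLeft F b ∘ₗ (FiniteField.frobeniusAlgHom F K).toLinearMap

theorem linearizedBinomial_apply (a b x : K) :
    linearizedBinomial (F := F) a b x = a * x + b * x ^ Fintype.card F := by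
  simp [linearizedBinomial]

theorem mem_range_algebraMap_of_pow_card_eq [Finite K] {t : K} (ht : t ^ Fintype.card F = t) :
    t ∈ Set.range (algebraMap F K) := by
  rw [IsGalois.mem_range_algebraMap_iff_fixed]
  intro σ
  obtain ⟨n, rfl⟩ := (FiniteField.bijective_frobeniusAlgEquivOfAlgebraic_pow F K).2 σ
  change (FiniteField.frobeniusAlgEquivOfAlgebraic F K ^ n.1) t = t
  rw [AlgEquiv.coe_pow]
  exact Function.iterate_fixed ht n.1

theorem finrank_ker_linearizedBinomial_le_one [Finite K] {a b : K} (hab : (a, b) ≠ 0) :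
    Module.finrank F (LinearMap.ker (linearizedBinomial (F := F) a b)) ≤ 1 := by
  by_cases hbot : LinearMap.ker (linearizedBinomial (F := F) a b) = ⊥
  · rw [hbot, finrank_bot]
    exact zero_le_one
  obtain ⟨x, hx, hx0⟩ := Submodule.exists_mem_ne_zero_of_ne_bot hbot
  refine finrank_le_one ⟨x, hx⟩ ?_
  rintro ⟨y, hy⟩
  rw [LinearMap.mem_ker, linearizedBinomial_apply] at hx hy
  have hb : b ≠ 0 := by
    rintro rfl
    have ha : a = 0 := by simpa [hx0] using hx
    exact hab (by simp [ha])
  have hfix : (y / x) ^ Fintype.card F = y / x := by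
    rw [div_pow, div_eq_div_iff (pow_ne_zero _ hx0) hx0]
    apply mul_left_cancel₀ hb
    linear_combination x * hy - y * hx
  obtain ⟨c, hc⟩ := mem_range_algebraMap_of_pow_card_eq hfix
  exact ⟨c, Subtype.ext (by simp [Algebra.smul_def, hc, hx0])⟩

end LinearizedBinomial

section Product

open Module LinearAlgebra.Projectivization

variable {F A B : Type*} [Field F] [AddCommGroup A] [Module F A] [AddCommGroup B] [Module F B]

/-- The graph of a linear map `f : U → B` on a subspace `U` of `A`, as a subspace of `A × B`. -/
def liftedSubspace (U : Submodule F A) (f : U →ₗ[F] B) : Submodule F (A × B) :=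
  LinearMap.range (U.subtype.prod f)

theorem mem_liftedSubspace {U : Submodule F A} {f : U →ₗ[F] B} {z : A × B} :
    z ∈ liftedSubspace U f ↔ ∃ u : U, (u : A) = z.1 ∧ f u = z.2 := by
  simp [liftedSubspace, Prod.ext_iff]

theorem finrank_liftedSubspace (U : Submodule F A) (f : U →ₗ[F] B) :
    finrank F (liftedSubspace U f) = finrank F U := by
  refine LinearMap.finrank_range_of_inj fun u v huv => Subtype.ext ?_
  simpa using congrArg Prod.fst huv

theorem map_fst_liftedSubspace (U : Submodule F A) (f : U →ₗ[F] B) :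
    (liftedSubspace U f).map (LinearMap.fst F A B) = U := by
  rw [liftedSubspace, ← LinearMap.range_comp, LinearMap.fst_prod, Submodule.range_subtype]

/-- For a point `P` of the dual of `B`, the product of the image of `P` in `A` and the hyperplane of
`B` annihilated by `P`. -/
noncomputable def hyperplaneSubspace (ι : Dual F B →ₗ[F] A) (P : ℙ F (Dual F B)) :
    Submodule F (A × B) :=
  (P.submodule.map ι).prod P.submodule.dualCoannihilator

theorem map_fst_hyperplaneSubspace (ι : Dual F B →ₗ[F] A) (P : ℙ F (Dual F B)) :
    (hyperplaneSubspace ι P).map (LinearMap.fst F A B) = P.submodule.map ι :=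
  Submodule.prod_map_fst _ _

variable [FiniteDimensional F A]

theorem finrank_liftedSubspace_inf_le (U : Submodule F A) (f : U →ₗ[F] B)
    (Y : Submodule F (A × B)) :
    finrank F ↥(liftedSubspace U f ⊓ Y) ≤ finrank F ↥(U ⊓ Y.map (LinearMap.fst F A B)) := by
  have hmaps : ∀ z ∈ liftedSubspace U f ⊓ Y,
      LinearMap.fst F A B z ∈ U ⊓ Y.map (LinearMap.fst F A B) := by
    intro z hz
    refine ⟨?_, Submodule.mem_map_of_mem hz.2⟩
    obtain ⟨u, hu, -⟩ := mem_liftedSubspace.1 hz.1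
    rw [LinearMap.fst_apply, ← hu]
    exact u.2
  refine LinearMap.finrank_le_finrank_of_injective
    (f := (LinearMap.fst F A B).restrict hmaps) ?_
  rintro ⟨z, hz⟩ ⟨w, hw⟩ hzw
  obtain ⟨u, hu, hfu⟩ := mem_liftedSubspace.1 hz.1
  obtain ⟨v, hv, hfv⟩ := mem_liftedSubspace.1 hw.1
  have h1 : z.1 = w.1 := by simpa using congrArg Subtype.val hzw
  have huv : u = v := Subtype.ext (by rw [hu, hv, h1])
  exact Subtype.ext (Prod.ext h1 (by rw [← hfu, ← hfv, huv]))

theorem finrank_liftedSubspace_inf_liftedSubspace_le (U : Submodule F A) (f g : U →ₗ[F] B) :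
    finrank F ↥(liftedSubspace U f ⊓ liftedSubspace U g) ≤
      finrank F (LinearMap.ker (f - g)) := by
  have hle : liftedSubspace U f ⊓ liftedSubspace U g ≤
      (LinearMap.ker (f - g)).map (U.subtype.prod f) := by
    rintro z ⟨hzf, hzg⟩
    obtain ⟨u, hu, hfu⟩ := mem_liftedSubspace.1 hzf
    obtain ⟨v, hv, hgv⟩ := mem_liftedSubspace.1 hzg
    have huv : u = v := Subtype.ext (hu.trans hv.symm)
    subst huv
    exact ⟨u, by simp [hfu, hgv], Prod.ext hu hfu⟩
  exact (Submodule.finrank_mono hle).trans (Submodule.finrank_map_le _ _)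

variable [FiniteDimensional F B]

theorem finrank_prod_submodule (U : Submodule F A) (V : Submodule F B) :
    finrank F (U.prod V) = finrank F U + finrank F V := by
  have hrange : LinearMap.range (U.subtype.prodMap V.subtype) = U.prod V := by
    rw [LinearMap.range_prodMap, Submodule.range_subtype, Submodule.range_subtype]
  rw [← hrange, LinearMap.finrank_range_of_inj
    (U.injective_subtype.prodMap V.injective_subtype), finrank_prod]

theorem finrank_hyperplaneSubspace {ι : Dual F B →ₗ[F] A} (hι : Function.Injective ι)
    (P : ℙ F (Dual F B)) : finrank F (hyperplaneSubspace ι P) = finrank F B := by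
  rw [hyperplaneSubspace, finrank_prod_submodule,
    ← (Submodule.equivMapOfInjective ι hι P.submodule).finrank_eq,
    Subspace.finrank_add_finrank_dualCoannihilator_eq]

theorem finrank_hyperplaneSubspace_inf_le {ι : Dual F B →ₗ[F] A} (hι : Function.Injective ι)
    {P Q : ℙ F (Dual F B)} (hPQ : P ≠ Q) :
    finrank F ↥(hyperplaneSubspace ι P ⊓ hyperplaneSubspace ι Q) ≤ finrank F B - 2 := by
  have hinf : P.submodule ⊓ Q.submodule = ⊥ := by
    by_contra hne
    have hpos : 1 ≤ finrank F ↥(P.submodule ⊓ Q.submodule) := by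
      rwa [Submodule.one_le_finrank_iff]
    have hP := Submodule.eq_of_le_of_finrank_le
      (inf_le_left : P.submodule ⊓ Q.submodule ≤ P.submodule) (P.finrank_submodule.trans_le hpos)
    have hQ := Submodule.eq_of_le_of_finrank_le
      (inf_le_right : P.submodule ⊓ Q.submodule ≤ Q.submodule) (Q.finrank_submodule.trans_le hpos)
    exact hPQ (Projectivization.submodule_injective (hP.symm.trans hQ))
  have hsup : finrank F ↥(P.submodule ⊔ Q.submodule) = 2 := by
    have h := Submodule.finrank_sup_add_finrank_inf_eq P.submodule Q.submodule
    rwa [hinf, finrank_bot, add_zero, P.finrank_submodule, Q.finrank_submodule] at h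
  have h := Subspace.finrank_add_finrank_dualCoannihilator_eq (P.submodule ⊔ Q.submodule)
  rw [hyperplaneSubspace, hyperplaneSubspace, Submodule.prod_inf_prod, finrank_prod_submodule,
    ← Submodule.map_inf _ hι, hinf, Submodule.map_bot, finrank_bot,
    ← Submodule.dualCoannihilator_sup_eq]
  omega

end Product

theorem exists_field_extension_finrank_eq (F : Type*) [Field F] [Finite F] (n : ℕ) [NeZero n] :
    ∃ (K : Type) (_ : Field K) (_ : Finite K) (_ : Algebra F K), Module.finrank F K = n := by
  obtain ⟨p, _⟩ := CharP.exists F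
  have : Fact p.Prime := ⟨CharP.char_is_prime F p⟩
  exact ⟨FiniteField.Extension F p n, inferInstance, inferInstance, inferInstance,
    FiniteField.finrank_extension F p n⟩

open Module LinearAlgebra.Projectivization in
/-- The linkage of a code `S` with the maps `x ↦ a x + b x ^ |F|`, enlarged by the subspaces
`hyperplaneSubspace ι P`. -/
theorem exists_linkage_code {F A : Type*} [Field F] [Fintype F] [AddCommGroup A] [Module F A]
    [FiniteDimensional F A] (hA : 3 ≤ finrank F A) (S : Set (Submodule F A))
    (hS : ∀ X ∈ S, finrank F X = 3)
    (hdist : ∀ X ∈ S, ∀ Y ∈ S, X ≠ Y → 4 ≤ subspaceDist X Y)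
    (W : Type*) [AddCommGroup W] [Module F W] [FiniteDimensional F W]
    (hW : finrank F W = finrank F A + 3) :
    ∃ T : Set (Submodule F W),
      T.ncard = S.ncard * Fintype.card F ^ 6 + (Fintype.card F ^ 2 + Fintype.card F + 1) ∧
      (∀ X ∈ T, finrank F X = 3) ∧ ∀ X ∈ T, ∀ Y ∈ T, X ≠ Y → 4 ≤ subspaceDist X Y := by
  obtain ⟨K, _, _, _, hK⟩ := exists_field_extension_finrank_eq F 3
  have : Module.Finite F K := .of_finite
  have : Finite A := Module.finite_of_finite F
  have : Finite (Dual F K) := Module.finite_of_finite F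
  obtain ⟨ι, hι⟩ : ∃ ι : Dual F K →ₗ[F] A, Function.Injective ι :=
    finrank_le_iff_exists_linearMap.mp (by rwa [Subspace.dual_finrank_eq, hK])
  let φ (U : S) : U.1 ≃ₗ[F] K := LinearEquiv.ofFinrankEq _ _ (by rw [hS U U.2, hK])
  let word (c : S × (K × K)) : Submodule F (A × K) :=
    liftedSubspace c.1.1 (linearizedBinomial c.2.1 c.2.2 ∘ₗ (φ c.1).toLinearMap)
  have hmixed (c : S × (K × K)) (P : ℙ F (Dual F K)) :
      finrank F ↥(word c ⊓ hyperplaneSubspace ι P) ≤ 1 :=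
    calc
      _ ≤ finrank F ↥(c.1.1 ⊓ P.submodule.map ι) := by
        rw [← map_fst_hyperplaneSubspace]
        exact finrank_liftedSubspace_inf_le _ _ _
      _ ≤ finrank F (P.submodule.map ι) := Submodule.finrank_mono inf_le_right
      _ ≤ 1 := (Submodule.finrank_map_le _ _).trans P.finrank_submodule.le
  have hword (c d : S × (K × K)) (hcd : c ≠ d) : finrank F ↥(word c ⊓ word d) ≤ 1 := by
    obtain ⟨U, a, b⟩ := c
    obtain ⟨V, a', b'⟩ := d
    by_cases hUV : U = V
    · subst hUV
      refine (finrank_liftedSubspace_inf_liftedSubspace_le _ _ _).trans ?_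
      have hsub : linearizedBinomial (F := F) a b ∘ₗ (φ U).toLinearMap -
          linearizedBinomial a' b' ∘ₗ (φ U).toLinearMap =
          linearizedBinomial (a - a') (b - b') ∘ₗ (φ U).toLinearMap := by
        ext u
        simp only [LinearMap.sub_apply, LinearMap.comp_apply, linearizedBinomial_apply]
        ring
      rw [hsub, LinearMap.ker_comp, Submodule.comap_equiv_eq_map_symm, LinearEquiv.finrank_map_eq]
      refine finrank_ker_linearizedBinomial_le_one fun h => hcd ?_
      simp only [Prod.mk_eq_zero, sub_eq_zero] at h
      rw [h.1, h.2]
    · refine (finrank_liftedSubspace_inf_le _ _ _).trans ?_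
      rw [map_fst_liftedSubspace, ← four_le_subspaceDist_iff (hS U U.2) (hS V V.2)]
      exact hdist U U.2 V V.2 fun h => hUV (Subtype.ext h)
  obtain ⟨T, hT, hT'⟩ := exists_code_of_family (W := W) (by rw [finrank_prod, hK, hW])
    (Sum.elim word (hyperplaneSubspace ι)) (by
      rintro (c | P)
      · exact (finrank_liftedSubspace _ _).trans (hS c.1 c.1.2)
      · exact (finrank_hyperplaneSubspace hι P).trans hK) (by
      rintro (c | P) (d | Q) hne
      · exact hword c d fun h => hne (congrArg Sum.inl h)
      · exact hmixed c Q
      · rw [inf_comm]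
        exact hmixed d P
      · refine (finrank_hyperplaneSubspace_inf_le hι fun h => hne (congrArg Sum.inr h)).trans ?_
        rw [hK])
  refine ⟨T, hT.trans ?_, hT'⟩
  rw [Nat.card_sum, Nat.card_prod, Nat.card_prod, Nat.card_coe_set_eq,
    Module.natCard_eq_pow_finrank (K := F) (V := K), hK,
    Projectivization.card_of_finrank F _ (Subspace.dual_finrank_eq.trans hK),
    Nat.card_eq_fintype_card, Finset.sum_range_succ, Finset.sum_range_succ, Finset.sum_range_one]
  ring

theorem statement18 (q N : ℕ) (hq : IsPrimePow q)
    (F : Type) [Field F] [Fintype F] (hcard : Fintype.card F = q)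
    (h : ∃ S : Set (Submodule F (Fin 7 → F)), S.ncard = N ∧
      (∀ X ∈ S, Module.finrank F ↥X = 3) ∧
      (∀ X ∈ S, ∀ Y ∈ S, X ≠ Y → 4 ≤ subspaceDist X Y)) :
    ∃ S : Set (Submodule F (Fin 10 → F)),
      S.ncard = N * q ^ 6 + (q ^ 2 + q + 1) ∧
      (∀ X ∈ S, Module.finrank F ↥X = 3) ∧
      (∀ X ∈ S, ∀ Y ∈ S, X ≠ Y → 4 ≤ subspaceDist X Y) := by
  subst hcard
  obtain ⟨S, rfl, hS, hdist⟩ := h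
  exact exists_linkage_code (by simp) S hS hdist (Fin 10 → F) (by simp)
end
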